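/- arXiv:1312.7771 — 2 statements merged into one kernel-verified Lean document; each statement's English description precedes it below -/
import Mathlib

section
/- The subgroup H of SL(2,ℤ) generated by the six matrices [[26269, -100820],[6845, -26271]], [[-82644, 317189],[-21533, 82644]], [[424, -1445],[125, -426]], [[-782, 2667],[-229, 781]], [[21644, -68445],[6845, -21646]], and [[-20241, 64009],[-6400, 20239]] has infinite index in SL(2,ℤ), and its absolute trace set equals all of ℕ: {|tr γ| : γ ∈ H} = ℕ. -/
open scoped MatrixGroups

/-- The absolute trace set of a subgroup of `SL(2, ℤ)`, as a set of natural numbers. -/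
def absTraceSet (H : Subgroup SL(2, ℤ)) : Set ℕ :=
  {n : ℕ | ∃ γ ∈ H, (Matrix.trace (γ : Matrix (Fin 2) (Fin 2) ℤ)).natAbs = n}

def h₁ : SL(2, ℤ) := ⟨!![26269, -100820; 6845, -26271], by norm_num [Matrix.det_fin_two_of]⟩
def h₂ : SL(2, ℤ) := ⟨!![-82644, 317189; -21533, 82644], by norm_num [Matrix.det_fin_two_of]⟩
def h₃ : SL(2, ℤ) := ⟨!![424, -1445; 125, -426], by norm_num [Matrix.det_fin_two_of]⟩
def h₄ : SL(2, ℤ) := ⟨!![-782, 2667; -229, 781], by norm_num [Matrix.det_fin_two_of]⟩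
def h₅ : SL(2, ℤ) := ⟨!![21644, -68445; 6845, -21646], by norm_num [Matrix.det_fin_two_of]⟩
def h₆ : SL(2, ℤ) := ⟨!![-20241, 64009; -6400, 20239], by norm_num [Matrix.det_fin_two_of]⟩

section PingPong

variable {G ι : Type*} [Group G]

/-- `IsPingPongReduced K Z o g` says that `g` is a product `k₁ ⋯ kₘ z` with `z ∈ Z`, each `kⱼ` in
some `K i` but not in `Z`, and consecutive indices distinct; `o` is the index of `k₁`, if any. -/
inductive IsPingPongReduced (K : ι → Subgroup G) (Z : Subgroup G) : Option ι → G → Prop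
  | base {z : G} : z ∈ Z → IsPingPongReduced K Z none z
  | step {o : Option ι} {i : ι} {k g : G} : o ≠ some i → k ∈ K i → k ∉ Z →
      IsPingPongReduced K Z o g → IsPingPongReduced K Z (some i) (k * g)

namespace IsPingPongReduced

variable {K : ι → Subgroup G} {Z : Subgroup G}

theorem normal_mul [hZ : Z.Normal] {o : Option ι} {g : G} (h : IsPingPongReduced K Z o g) :
    ∀ z ∈ Z, IsPingPongReduced K Z o (z * g) := by
  induction h with
  | base hz => exact fun z' hz' => .base (Z.mul_mem hz' hz)
  | @step o i k g ho hk hkZ _ ih =>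
    intro z hz
    have hz' : k⁻¹ * z * k ∈ Z := by simpa using hZ.conj_mem z hz k⁻¹
    have := IsPingPongReduced.step ho hk hkZ (ih _ hz')
    rwa [show k * (k⁻¹ * z * k * g) = z * (k * g) by group] at this

theorem exists_mul [Z.Normal] {o : Option ι} {i : ι} {k g : G} (hk : k ∈ K i)
    (h : IsPingPongReduced K Z o g) : ∃ o', IsPingPongReduced K Z o' (k * g) := by
  by_cases hkZ : k ∈ Z
  · exact ⟨o, h.normal_mul k hkZ⟩
  by_cases ho : o = some i
  · cases h with
    | base => simp at ho
    | @step o' j k' g ho' hk' _ hg =>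
      obtain rfl : j = i := by simpa using ho
      rw [← mul_assoc]
      by_cases hkk : k * k' ∈ Z
      · exact ⟨o', hg.normal_mul _ hkk⟩
      · exact ⟨_, .step ho' ((K j).mul_mem hk hk') hkk hg⟩
  · exact ⟨_, .step ho hk hkZ h⟩

theorem exists_of_mem_iSup [Z.Normal] {g : G} (hg : g ∈ ⨆ i, K i) :
    ∃ o, IsPingPongReduced K Z o g := by
  rw [Subgroup.iSup_eq_closure] at hg
  induction hg using Subgroup.closure_induction_left with
  | one => exact ⟨none, .base Z.one_mem⟩
  | mul_left x hx y _ ih =>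
    obtain ⟨i, hi⟩ := Set.mem_iUnion.1 hx
    exact ih.elim fun o ho => ho.exists_mul hi
  | inv_mul_cancel x hx y _ ih =>
    obtain ⟨i, hi⟩ := Set.mem_iUnion.1 hx
    exact ih.elim fun o ho => ho.exists_mul ((K i).inv_mem hi)

theorem mem_of_pingPong {A : Option ι → Set G} (hZ : (Z : Set G) ⊆ A none)
    (hA : ∀ o i, o ≠ some i → ∀ k ∈ K i, k ∉ Z → ∀ g ∈ A o, k * g ∈ A (some i))
    {o : Option ι} {g : G} (h : IsPingPongReduced K Z o g) : g ∈ A o := by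
  induction h with
  | base hz => exact hZ hz
  | step ho hk hkZ _ ih => exact hA _ _ ho _ hk hkZ _ ih

end IsPingPongReduced

end PingPong

section Intervals

/-- The product of the linear forms vanishing on the lines of slopes `x` and `y`, at the first
column of `g`. It is nonpositive when `g • ∞` lies between `x` and `y`. -/
def columnForm (x y : ℚ) (g : SL(2, ℤ)) : ℚ :=
  ((g 0 0 : ℚ) - x * g 1 0) * ((g 0 0 : ℚ) - y * g 1 0)

theorem mul_nonneg_of_disjoint_intervals {l₁ u₁ l₂ u₂ a c : ℚ} (h₁ : l₁ ≤ u₁) (h₂ : l₂ ≤ u₂)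
    (hd : u₁ ≤ l₂ ∨ u₂ ≤ l₁) (h : (a - l₁ * c) * (a - u₁ * c) ≤ 0) :
    0 ≤ (a - l₂ * c) * (a - u₂ * c) := by
  by_contra! hneg
  rcases mul_neg_iff.1 hneg with ⟨p, q⟩ | ⟨p, q⟩ <;>
  rcases mul_nonpos_iff.1 h with ⟨r, s⟩ | ⟨r, s⟩ <;>
  rcases hd with hd | hd <;> rcases le_total 0 c with hc | hc <;>
  nlinarith

theorem sub_mul_sub_nonneg {f e : ℚ} (h : f * (f - e) ≤ 0) {k : ℤ} (hk : k ≠ 0) :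
    0 ≤ (f - k * e) * (f - (k + 1) * e) := by
  have hk' : (k : ℚ) ≤ -1 ∨ (1 : ℚ) ≤ k := by
    rcases lt_or_gt_of_ne hk with h | h
    · exact .inl (by exact_mod_cast Int.le_sub_one_of_lt h)
    · exact .inr (by exact_mod_cast h)
  rcases mul_nonpos_iff.1 h with ⟨r, s⟩ | ⟨r, s⟩ <;> rcases hk' with hk' | hk'
  · exact mul_nonneg (by nlinarith) (by nlinarith)
  · exact mul_nonneg_of_nonpos_of_nonpos (by nlinarith) (by nlinarith)
  · exact mul_nonneg_of_nonpos_of_nonpos (by nlinarith) (by nlinarith)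
  · exact mul_nonneg (by nlinarith) (by nlinarith)

end Intervals

/-- Integral powers of a matrix of trace `-2`. -/
theorem exists_coe_zpow_eq {g : SL(2, ℤ)} (hg : g 0 0 + g 1 1 = -2) (k : ℤ) :
    ∃ e : ℤ, (e = 1 ∨ e = -1) ∧ ((g ^ k : SL(2, ℤ)) : Matrix (Fin 2) (Fin 2) ℤ) =
      !![e * (1 - k * (1 + g 0 0)), -(e * k * g 0 1);
        -(e * k * g 1 0), e * (1 - k * (1 + g 1 1))] := by
  have hdet := g.2
  rw [Matrix.det_fin_two] at hdet
  have hd : g 1 1 = -2 - g 0 0 := by linarith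
  rw [hd] at hdet
  induction k with
  | zero => exact ⟨1, by simp [Matrix.one_fin_two]⟩
  | succ k ih =>
    obtain ⟨e, he, h⟩ := ih
    refine ⟨-e, by lia, ?_⟩
    rw [zpow_add_one, Matrix.SpecialLinearGroup.coe_mul, h]
    ext i j
    fin_cases i <;> fin_cases j <;> simp [Matrix.mul_apply, Fin.sum_univ_two, hd]
    · linear_combination e * k * hdet
    · ring
    · ring
    · linear_combination e * k * hdet
  | pred k ih =>
    obtain ⟨e, he, h⟩ := ih
    refine ⟨-e, by lia, ?_⟩
    rw [zpow_sub_one, Matrix.SpecialLinearGroup.coe_mul, h, Matrix.SpecialLinearGroup.coe_inv,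
      Matrix.adjugate_fin_two]
    ext i j
    fin_cases i <;> fin_cases j <;> simp [Matrix.mul_apply, Fin.sum_univ_two, hd]
    · linear_combination e * k * hdet
    · ring
    · ring
    · linear_combination e * k * hdet

/-- If `g` has trace `-2` and maps the slope `y` to `x`, then every nontrivial power of `g` maps
the complement of the interval between `x` and `y` into that interval. -/
theorem columnForm_zpow_mul_nonpos {g : SL(2, ℤ)} {x y m : ℚ} (hg : g 0 0 + g 1 1 = -2)
    (hm : m < 0) (hx : (g 0 0 : ℚ) - x * g 1 0 = -m) (hy : (g 0 1 : ℚ) - x * g 1 1 = m * y)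
    {k : ℤ} (hk : k ≠ 0) {w : SL(2, ℤ)} (hw : 0 ≤ columnForm x y w) :
    columnForm x y (g ^ k * w) ≤ 0 := by
  obtain ⟨e, he, h⟩ := exists_coe_zpow_eq hg k
  have he2 : (e : ℚ) ^ 2 = 1 := by rcases he with rfl | rfl <;> norm_num
  have hd : (g 1 1 : ℚ) = -2 - g 0 0 := by
    have : g 1 1 = -2 - g 0 0 := by linarith
    exact_mod_cast this
  have hdet : (g 0 0 : ℚ) * (-2 - g 0 0) - g 0 1 * g 1 0 = 1 := by
    have := g.2
    rw [Matrix.det_fin_two] at this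
    rw [← hd]
    exact_mod_cast this
  unfold columnForm at hw ⊢
  simp only [Matrix.SpecialLinearGroup.coe_mul, h, Matrix.mul_apply, Fin.sum_univ_two,
    Matrix.of_apply, Matrix.cons_val', Matrix.cons_val_zero, Matrix.cons_val_one,
    Matrix.cons_val_fin_one]
  push_cast
  rw [hd] at hy ⊢
  set a : ℚ := ((w 0 0 : ℤ) : ℚ)
  set c : ℚ := ((w 1 0 : ℤ) : ℚ)
  set f : ℚ := a - x * c with hf
  set E : ℚ := f - m * (a - y * c) with hE
  have hfE : f * (f - E) ≤ 0 := by
    have : f * (f - E) = m * (f * (a - y * c)) := by rw [hE]; ring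
    rw [this]
    exact mul_nonpos_of_nonpos_of_nonneg hm.le hw
  have key := sub_mul_sub_nonneg hfE hk
  by_contra! hpos
  refine absurd key (not_le.2 ?_)
  convert mul_neg_of_neg_of_pos hm hpos using 1
  set p : ℚ := e * (1 - k * (1 + g 0 0)) * a + -(e * k * g 0 1) * c with hp
  set q : ℚ := -(e * k * g 1 0) * a + e * (1 - k * (1 + (-2 - g 0 0))) * c with hq
  have h1 : p - x * q = e * (f - k * E) := by
    rw [hp, hq, hE, hf]
    linear_combination (-e * k * a) * hx + (-e * k * c) * hy
  have h2 : m * (p - y * q) = e * (f - (k + 1) * E) := by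
    rw [hE, hf]
    have : m * (p - y * q) =
      -((g 0 0 - x * g 1 0) * p + (g 0 1 - x * (-2 - g 0 0)) * q) := by
      linear_combination p * hx + q * hy
    rw [this, hp, hq]
    linear_combination (-e * k * (a - x * c)) * hdet +
      (-e * a * (k + 1)) * hx + (-e * c * (k + 1)) * hy
  linear_combination -(m * (p - y * q)) * h1 - e * (f - k * E) * h2 -
    (f - k * E) * (f - (k + 1) * E) * he2

/-- Trace of `g ^ k * w` up to sign, when `g` has trace `-2`. -/
theorem natAbs_trace_zpow_mul {g : SL(2, ℤ)} (hg : g 0 0 + g 1 1 = -2) (w : SL(2, ℤ)) (k : ℤ) :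
    (Matrix.trace ((g ^ k * w : SL(2, ℤ)) : Matrix (Fin 2) (Fin 2) ℤ)).natAbs =
      (w.1.trace - k * (w.1.trace + (g * w).1.trace)).natAbs := by
  obtain ⟨e, he, h⟩ := exists_coe_zpow_eq hg k
  have : Matrix.trace ((g ^ k * w : SL(2, ℤ)) : Matrix (Fin 2) (Fin 2) ℤ) =
      e * (w.1.trace - k * (w.1.trace + (g * w).1.trace)) := by
    simp only [Matrix.SpecialLinearGroup.coe_mul, h, Matrix.trace_fin_two, Matrix.mul_apply,
      Fin.sum_univ_two, Matrix.of_apply, Matrix.cons_val', Matrix.cons_val_zero,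
      Matrix.cons_val_one, Matrix.cons_val_fin_one]
    ring
  rw [this, Int.natAbs_mul]
  rcases he with rfl | rfl <;> simp

theorem mem_absTraceSet_of_dvd {H : Subgroup SL(2, ℤ)} {g w : SL(2, ℤ)} (hgH : g ∈ H)
    (hwH : w ∈ H) (hg : g 0 0 + g 1 1 = -2) {n : ℕ}
    (hn : w.1.trace + (g * w).1.trace ∣ w.1.trace - n ∨
      w.1.trace + (g * w).1.trace ∣ w.1.trace + n) : n ∈ absTraceSet H := by
  rcases hn with ⟨k, hk⟩ | ⟨k, hk⟩ <;>
  · refine ⟨g ^ k * w, H.mul_mem (H.zpow_mem hgH k) hwH, ?_⟩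
    rw [natAbs_trace_zpow_mul hg]
    lia

/-- The six given generators. -/
def generator : Fin 6 → SL(2, ℤ) := ![h₁, h₂, h₃, h₄, h₅, h₆]

/-- One endpoint of the ping-pong interval of each generator. -/
def leftEndpoint : Fin 6 → ℚ := ![23 / 6, 687 / 179, 10 / 3, 75 / 22, 98 / 31, 487 / 154]

/-- The other endpoint of the ping-pong interval of each generator. -/
def rightEndpoint : Fin 6 → ℚ := ![687 / 179, 403 / 105, 75 / 22, 24 / 7, 487 / 154, 19 / 6]

theorem leftEndpoint_le (i : Fin 6) : leftEndpoint i ≤ rightEndpoint i := by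
  fin_cases i <;> norm_num [leftEndpoint, rightEndpoint]

theorem intervals_disjoint {i j : Fin 6} (h : i ≠ j) :
    rightEndpoint i ≤ leftEndpoint j ∨ rightEndpoint j ≤ leftEndpoint i := by
  revert h
  fin_cases i <;> fin_cases j <;> norm_num [leftEndpoint, rightEndpoint]

/-- The elements sending `∞` to itself, respectively into the interval of a generator. -/
def pingPongSet : Option (Fin 6) → Set SL(2, ℤ)
  | none => {g | g 1 0 = 0}
  | some i => {g | columnForm (leftEndpoint i) (rightEndpoint i) g ≤ 0}

theorem columnForm_nonneg_of_mem {o : Option (Fin 6)} {i : Fin 6} (ho : o ≠ some i)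
    {g : SL(2, ℤ)} (hg : g ∈ pingPongSet o) :
    0 ≤ columnForm (leftEndpoint i) (rightEndpoint i) g := by
  cases o with
  | none =>
    have : g 1 0 = 0 := hg
    simpa [columnForm, this] using mul_self_nonneg _
  | some j =>
    exact mul_nonneg_of_disjoint_intervals (leftEndpoint_le j) (leftEndpoint_le i)
      (intervals_disjoint fun h => ho (congrArg some h)) hg

theorem apply_eq_zero_of_mem_center {z : SL(2, ℤ)} (hz : z ∈ Subgroup.center SL(2, ℤ))
    {i j : Fin 2} (hij : i ≠ j) : z i j = 0 := by
  obtain ⟨r, -, hr⟩ := Matrix.SpecialLinearGroup.mem_center_iff.1 hz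
  rw [← hr, Matrix.scalar_apply, Matrix.diagonal_apply_ne _ hij]

theorem neg_one_mem_center : (-1 : SL(2, ℤ)) ∈ Subgroup.center SL(2, ℤ) :=
  Subgroup.mem_center_iff.2 fun g => by simp

theorem columnForm_neg (x y : ℚ) (g : SL(2, ℤ)) : columnForm x y (-g) = columnForm x y g := by
  simp only [columnForm, Matrix.SpecialLinearGroup.coe_neg, Matrix.neg_apply]
  push_cast
  ring

theorem h₂_sq : h₂ ^ 2 = -1 := by
  rw [pow_two]
  ext i j
  fin_cases i <;> fin_cases j <;> rfl

theorem h₄_cube : h₄ ^ 3 = 1 := by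
  rw [pow_three]
  ext i j
  fin_cases i <;> fin_cases j <;> rfl

theorem columnForm_h₂_mul_nonpos {w : SL(2, ℤ)}
    (hw : 0 ≤ columnForm (687 / 179) (403 / 105) w) :
    columnForm (687 / 179) (403 / 105) (h₂ * w) ≤ 0 := by
  simp only [columnForm, Matrix.SpecialLinearGroup.coe_mul, Matrix.mul_apply,
    Fin.sum_univ_two] at hw ⊢
  simp [h₂]
  nlinarith

theorem columnForm_h₄_mul_nonpos {w : SL(2, ℤ)} (hw : 0 ≤ columnForm (75 / 22) (24 / 7) w) :
    columnForm (75 / 22) (24 / 7) (h₄ * w) ≤ 0 ∧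
      columnForm (75 / 22) (24 / 7) (h₄ * (h₄ * w)) ≤ 0 := by
  simp only [columnForm, Matrix.SpecialLinearGroup.coe_mul, Matrix.mul_apply,
    Fin.sum_univ_two] at hw ⊢
  simp [h₄]
  constructor <;>
    nlinarith [sq_nonneg ((w 0 0 : ℚ) - 75 / 22 * w 1 0), sq_nonneg ((w 0 0 : ℚ) - 24 / 7 * w 1 0)]

theorem columnForm_comm (x y : ℚ) (g : SL(2, ℤ)) : columnForm x y g = columnForm y x g :=
  mul_comm _ _

theorem columnForm_generator_zpow_mul_nonpos (i : Fin 6) {k : ℤ}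
    (hk : generator i ^ k ∉ Subgroup.center SL(2, ℤ)) {w : SL(2, ℤ)}
    (hw : 0 ≤ columnForm (leftEndpoint i) (rightEndpoint i) w) :
    columnForm (leftEndpoint i) (rightEndpoint i) (generator i ^ k * w) ≤ 0 := by
  have hk0 : k ≠ 0 := by
    rintro rfl
    exact hk (by simp)
  fin_cases i <;> simp [generator, leftEndpoint, rightEndpoint] at hk hw ⊢
  · exact columnForm_zpow_mul_nonpos (m := -(26269 - 23 / 6 * 6845)) (by simp [h₁]) (by norm_num)
      (by simp [h₁]) (by norm_num [h₁]) hk0 hw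
  · have h : h₂ ^ k = 1 ∨ h₂ ^ k = -1 ∨ h₂ ^ k = h₂ ∨ h₂ ^ k = -h₂ := by
      have hsq : h₂ * h₂ = -1 := by rw [← pow_two, h₂_sq]
      have h4 : h₂ ^ (4 : ℤ) = 1 := by
        rw [zpow_ofNat, show 4 = 2 * 2 by rfl, pow_mul, h₂_sq, neg_one_sq]
      rw [← Int.mul_ediv_add_emod k 4, zpow_add, zpow_mul, h4]
      have : k % 4 = 0 ∨ k % 4 = 1 ∨ k % 4 = 2 ∨ k % 4 = 3 := by lia
      rcases this with h | h | h | h <;> rw [h] <;> simp [zpow_ofNat, pow_succ, hsq]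
    rcases h with h | h | h | h <;> rw [h] at hk ⊢
    · exact absurd (Subgroup.one_mem _) hk
    · exact absurd neg_one_mem_center hk
    · exact columnForm_h₂_mul_nonpos hw
    · rw [neg_mul, columnForm_neg]
      exact columnForm_h₂_mul_nonpos hw
  · exact columnForm_zpow_mul_nonpos (m := -(424 - 10 / 3 * 125)) (by simp [h₃]) (by norm_num)
      (by simp [h₃]) (by norm_num [h₃]) hk0 hw
  · have h : h₄ ^ k = 1 ∨ h₄ ^ k = h₄ ∨ h₄ ^ k = h₄ * h₄ := by
      rw [← Int.mul_ediv_add_emod k 3, zpow_add, zpow_mul, zpow_ofNat, h₄_cube]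
      have : k % 3 = 0 ∨ k % 3 = 1 ∨ k % 3 = 2 := by lia
      rcases this with h | h | h <;> rw [h] <;> simp [zpow_ofNat, pow_two]
    rcases h with h | h | h <;> rw [h] at hk ⊢
    · exact absurd (Subgroup.one_mem _) hk
    · exact (columnForm_h₄_mul_nonpos hw).1
    · rw [mul_assoc]
      exact (columnForm_h₄_mul_nonpos hw).2
  · exact columnForm_zpow_mul_nonpos (m := -(21644 - 98 / 31 * 6845)) (by simp [h₅]) (by norm_num)
      (by simp [h₅]) (by norm_num [h₅]) hk0 hw
  · rw [columnForm_comm] at hw ⊢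
    exact columnForm_zpow_mul_nonpos (m := -(-20241 + 19 / 6 * 6400)) (by simp [h₆]) (by norm_num)
      (by norm_num [h₆]) (by norm_num [h₆]) hk0 hw

theorem closure_eq_iSup : Subgroup.closure {h₁, h₂, h₃, h₄, h₅, h₆} =
    ⨆ i, Subgroup.zpowers (generator i) := by
  simp_rw [Subgroup.zpowers_eq_closure, ← Subgroup.closure_iUnion]
  congr 1
  ext g
  simp [generator]
  tauto

/-- The subgroup of `SL(2, ℤ)` generated by the six explicit matrices has infinite index
and its absolute trace set is all of `ℕ`. -/
theorem explicit_subgroup_infinite_index_full_trace_set :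
    (Subgroup.closure {h₁, h₂, h₃, h₄, h₅, h₆}).index = 0 ∧
      absTraceSet (Subgroup.closure {h₁, h₂, h₃, h₄, h₅, h₆}) = Set.univ := by
  constructor
  · by_contra hindex
    obtain ⟨n, hn, -, hmem⟩ :=
      Subgroup.exists_pow_mem_of_index_ne_zero hindex ModularGroup.T
    rw [closure_eq_iSup] at hmem
    obtain ⟨o, ho⟩ := IsPingPongReduced.exists_of_mem_iSup (Z := Subgroup.center SL(2, ℤ)) hmem
    have hcoe := ModularGroup.coe_T_zpow n
    rw [zpow_natCast] at hcoe
    cases o with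
    | none =>
      cases ho with
      | base hz =>
        have h01 := apply_eq_zero_of_mem_center hz (i := 0) (j := 1) (by decide)
        simp [hcoe] at h01
        lia
    | some i =>
      have hA : columnForm (leftEndpoint i) (rightEndpoint i) (ModularGroup.T ^ n) ≤ 0 := by
        refine ho.mem_of_pingPong (A := pingPongSet) ?_ ?_
        · exact fun z hz => apply_eq_zero_of_mem_center hz (by decide)
        · rintro o i ho _ ⟨k, rfl⟩ hk g hg
          exact columnForm_generator_zpow_mul_nonpos i hk (columnForm_nonneg_of_mem ho hg)
      norm_num [columnForm, hcoe] at hA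
  · refine Set.eq_univ_of_forall fun n => ?_
    have hgen : ∀ g ∈ ({h₁, h₂, h₃, h₄, h₅, h₆} : Set SL(2, ℤ)),
        g ∈ Subgroup.closure {h₁, h₂, h₃, h₄, h₅, h₆} := fun g hg => Subgroup.subset_closure hg
    have hmod : (5 : ℤ) ∣ n ∨ ((5 : ℤ) ∣ n - 1 ∨ (5 : ℤ) ∣ n + 1) ∨
      ((5 : ℤ) ∣ n - 2 ∨ (5 : ℤ) ∣ n + 2) := by lia
    rcases hmod with h | h | h
    · refine mem_absTraceSet_of_dvd (hgen h₁ (by simp)) (hgen h₂ (by simp)) (by simp [h₁]) ?_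
      rw [show h₂.1.trace = 0 by rfl, show (h₁ * h₂).1.trace = 5 by rfl]
      lia
    · refine mem_absTraceSet_of_dvd (hgen h₃ (by simp)) (hgen h₄ (by simp)) (by simp [h₃]) ?_
      rw [show h₄.1.trace = -1 by rfl, show (h₃ * h₄).1.trace = 6 by rfl]
      lia
    · refine mem_absTraceSet_of_dvd (hgen h₆ (by simp)) (hgen h₅ (by simp)) (by simp [h₆]) ?_
      rw [show h₅.1.trace = -2 by rfl, show (h₆ * h₅).1.trace = 7 by rfl]
      lia
end

section
/- For every integer n ≥ 2, there exists a finitely generated subgroup H of the principal congruence subgroup Γ(n) ≤ SL(2,ℤ) such that H has infinite index in SL(2,ℤ) and {tr γ : γ ∈ H} = {tr γ : γ ∈ Γ(n)}. -/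
open scoped MatrixGroups

/-- The trace set of a subgroup of `SL(2, ℤ)`, as a set of integers. -/
def traceSet (H : Subgroup SL(2, ℤ)) : Set ℤ :=
  {t : ℤ | ∃ γ ∈ H, Matrix.trace (γ : Matrix (Fin 2) (Fin 2) ℤ) = t}

open ModularGroup

/-- The lower unitriangular matrix with lower left entry `t`. -/
def lowerUnipotent (t : ℤ) : SL(2, ℤ) := S * T ^ (-t) * S⁻¹

lemma coe_lowerUnipotent (t : ℤ) :
    (lowerUnipotent t : Matrix (Fin 2) (Fin 2) ℤ) = !![1, 0; t, 1] := by
  rw [lowerUnipotent, Matrix.SpecialLinearGroup.coe_mul, Matrix.SpecialLinearGroup.coe_mul,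
    coe_T_zpow, Matrix.SpecialLinearGroup.coe_inv, coe_S]
  simp [Matrix.adjugate_fin_two]

lemma lowerUnipotent_zpow (t k : ℤ) : lowerUnipotent t ^ k = lowerUnipotent (t * k) := by
  rw [lowerUnipotent, conj_zpow, ← zpow_mul, neg_mul, lowerUnipotent]

/-- Up to sign, `h` is an alternating product of nonzero powers of `f true` and `f false`; the
index records the leftmost factor, if there is one. -/
inductive IsAlternating (f : Bool → SL(2, ℤ)) : Option Bool → SL(2, ℤ) → Prop
  | one : IsAlternating f none 1
  | neg_one : IsAlternating f none (-1)
  | cons {i : Option Bool} {h : SL(2, ℤ)} (j : Bool) (k : ℤ) (hk : k ≠ 0) (hi : i ≠ some j)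
      (hh : IsAlternating f i h) : IsAlternating f (some j) (f j ^ k * h)

namespace IsAlternating

variable {f : Bool → SL(2, ℤ)}

lemma neg {i : Option Bool} {h : SL(2, ℤ)} (hh : IsAlternating f i h) :
    IsAlternating f i (-h) := by
  induction hh with
  | one => exact neg_one
  | neg_one => simpa using one
  | cons j k hk hi _ ih => simpa only [mul_neg] using cons j k hk hi ih

lemma exists_zpow_mul {i : Option Bool} {h : SL(2, ℤ)} (hh : IsAlternating f i h)
    (j : Bool) (k : ℤ) : ∃ i', IsAlternating f i' (f j ^ k * h) := by
  by_cases hi : i = some j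
  · subst hi
    cases hh with
    | cons _ l hl hi' hh =>
      rw [← mul_assoc, ← zpow_add]
      by_cases hkl : k + l = 0
      · exact ⟨_, by simpa [hkl] using hh⟩
      · exact ⟨_, cons j _ hkl hi' hh⟩
  · by_cases hk : k = 0
    · exact ⟨i, by simpa [hk] using hh⟩
    · exact ⟨_, cons j k hk hi hh⟩

lemma exists_of_mem_closure {h : SL(2, ℤ)}
    (hh : h ∈ Subgroup.closure {f true, f false, -1}) : ∃ i, IsAlternating f i h := by
  induction hh using Subgroup.closure_induction_left with
  | one => exact ⟨_, one⟩
  | mul_left x hx y _ ih =>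
    obtain ⟨i, hi⟩ := ih
    rcases hx with rfl | rfl | rfl
    · simpa using hi.exists_zpow_mul true 1
    · simpa using hi.exists_zpow_mul false 1
    · exact ⟨i, by simpa using hi.neg⟩
  | inv_mul_cancel x hx y _ ih =>
    obtain ⟨i, hi⟩ := ih
    rcases hx with rfl | rfl | rfl
    · simpa using hi.exists_zpow_mul true (-1)
    · simpa using hi.exists_zpow_mul false (-1)
    · exact ⟨i, by simpa using hi.neg⟩

end IsAlternating

/-- The regions of the plane used to play ping-pong with `T ^ a` and `lowerUnipotent b`. -/
def pingPongRegion (a b : ℤ) : Option Bool → ℤ → ℤ → Prop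
  | none, x, y => 2 * |x| < a * |y| ∧ 2 * |y| < b * |x|
  | some true, x, y => a * |y| < 2 * |x|
  | some false, x, y => b * |x| < 2 * |y|

lemma mul_abs_lt_two_mul_abs_add {a x y k : ℤ} (ha : 0 < a) (hk : k ≠ 0)
    (h : 2 * |x| < a * |y|) : a * |y| < 2 * |x + a * k * y| := by
  have h1 : |a * k * y| ≤ |x + a * k * y| + |x| := by
    simpa using abs_sub (x + a * k * y) x
  have h2 : a * |y| ≤ |a * k * y| := by
    rw [abs_mul, abs_mul, abs_of_pos ha]
    have := Int.one_le_abs hk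
    gcongr
    nlinarith
  linarith

lemma two_mul_abs_lt_of_mul_abs_lt {a b x y : ℤ} (ha : 0 < a) (hab : 4 ≤ a * b)
    (h : b * |x| < 2 * |y|) : 2 * |x| < a * |y| := by
  nlinarith [abs_nonneg x, abs_nonneg y, mul_lt_mul_of_pos_left h ha,
    mul_le_mul_of_nonneg_right hab (abs_nonneg x)]

/-- The generators of the ping-pong group. -/
def unipotentPair (a b : ℤ) : Bool → SL(2, ℤ)
  | true => T ^ a
  | false => lowerUnipotent b

lemma IsAlternating.pingPongRegion {a b p q : ℤ} (ha : 0 < a) (hb : 0 < b) (hab : 4 ≤ a * b)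
    (hpq : pingPongRegion a b none p q) {i : Option Bool} {h : SL(2, ℤ)}
    (hh : IsAlternating (unipotentPair a b) i h) :
    pingPongRegion a b i (h 0 0 * p + h 0 1 * q) (h 1 0 * p + h 1 1 * q) := by
  induction hh with
  | one => simpa using hpq
  | neg_one => simpa [_root_.pingPongRegion] using hpq
  | @cons i h j k hk hi hh ih =>
    set x := h 0 0 * p + h 0 1 * q with hx
    set y := h 1 0 * p + h 1 1 * q with hy
    cases j with
    | true =>
      have key : 2 * |x| < a * |y| := by
        match i, hi, ih with
        | none, _, ih => exact ih.1
        | some false, _, ih => exact two_mul_abs_lt_of_mul_abs_lt ha hab ih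
      have := mul_abs_lt_two_mul_abs_add ha hk key
      have e : ((unipotentPair a b true ^ k * h : SL(2, ℤ)) : Matrix (Fin 2) (Fin 2) ℤ) =
          !![1, a * k; 0, 1] * (h : Matrix (Fin 2) (Fin 2) ℤ) := by
        rw [Matrix.SpecialLinearGroup.coe_mul, unipotentPair, ← zpow_mul, coe_T_zpow]
      simp only [_root_.pingPongRegion, e, Matrix.mul_apply, Fin.sum_univ_two]
      convert this using 3 <;> simp [hx, hy] <;> ring
    | false =>
      have key : 2 * |y| < b * |x| := by
        match i, hi, ih with
        | none, _, ih => exact ih.2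
        | some true, _, ih => exact two_mul_abs_lt_of_mul_abs_lt hb (by linarith) ih
      have := mul_abs_lt_two_mul_abs_add hb hk key
      have e : ((unipotentPair a b false ^ k * h : SL(2, ℤ)) : Matrix (Fin 2) (Fin 2) ℤ) =
          !![1, 0; b * k, 1] * (h : Matrix (Fin 2) (Fin 2) ℤ) := by
        rw [Matrix.SpecialLinearGroup.coe_mul, unipotentPair, lowerUnipotent_zpow,
          coe_lowerUnipotent]
      simp only [_root_.pingPongRegion, e, Matrix.mul_apply, Fin.sum_univ_two]
      convert this using 3 <;> simp [hx, hy] <;> ring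

/-- The parabolic matrix fixing the vector `(p, q)`. -/
def parabolic (p q : ℤ) : SL(2, ℤ) :=
  ⟨!![1 - p * q, p ^ 2; -q ^ 2, 1 + p * q], by rw [Matrix.det_fin_two_of]; ring⟩

lemma coe_parabolic_pow (p q : ℤ) (m : ℕ) :
    ((parabolic p q ^ m : SL(2, ℤ)) : Matrix (Fin 2) (Fin 2) ℤ) =
      !![1 - m * (p * q), m * p ^ 2; -(m * q ^ 2), 1 + m * (p * q)] := by
  induction m with
  | zero => simp [Matrix.one_fin_two]
  | succ m ih =>
    rw [pow_succ, Matrix.SpecialLinearGroup.coe_mul, ih, parabolic, Matrix.mul_fin_two]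
    push_cast
    congr! 3 <;> ring_nf

lemma index_closure_unipotentPair {a b p q : ℤ} (ha : 0 < a) (hb : 0 < b) (hab : 4 ≤ a * b)
    (hq : q ≠ 0) (hpq : pingPongRegion a b none p q) :
    (Subgroup.closure {T ^ a, lowerUnipotent b, -1} : Subgroup SL(2, ℤ)).index = 0 := by
  by_contra hne
  obtain ⟨m, hm, -, hmem⟩ := Subgroup.exists_pow_mem_of_index_ne_zero hne (parabolic p q)
  obtain ⟨i, hi⟩ := IsAlternating.exists_of_mem_closure (f := unipotentPair a b) hmem
  have hr := hi.pingPongRegion ha hb hab hpq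
  have e := coe_parabolic_pow p q m
  generalize parabolic p q ^ m = g at *
  have e1 : g 0 0 * p + g 0 1 * q = p := by simp [e]; ring
  have e2 : g 1 0 * p + g 1 1 * q = q := by simp [e]; ring
  rw [e1, e2] at hr
  have h10 : g 1 0 ≠ 0 := by simp [e, hq, hm.ne']
  match i, hi, hr with
  | none, .one, _ => simp at h10
  | none, .neg_one, _ => simp at h10
  | some true, _, hr => exact lt_asymm hr hpq.1
  | some false, _, hr => exact lt_asymm hr hpq.2

lemma exists_trace_eq_of_mem_Gamma {n : ℕ} {γ : SL(2, ℤ)} (hγ : γ ∈ CongruenceSubgroup.Gamma n) :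
    ∃ k : ℤ, Matrix.trace (γ : Matrix (Fin 2) (Fin 2) ℤ) = 2 + n * n * k := by
  rw [CongruenceSubgroup.Gamma_mem] at hγ
  obtain ⟨h00, h01, h10, h11⟩ := hγ
  have hdet := γ.det_coe
  rw [Matrix.det_fin_two] at hdet
  rw [Matrix.trace_fin_two]
  obtain ⟨a, ha⟩ : (n : ℤ) ∣ γ 0 0 - 1 := by
    rw [← ZMod.intCast_zmod_eq_zero_iff_dvd]; simp [h00]
  obtain ⟨d, hd⟩ : (n : ℤ) ∣ γ 1 1 - 1 := by
    rw [← ZMod.intCast_zmod_eq_zero_iff_dvd]; simp [h11]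
  obtain ⟨b, hb⟩ := (ZMod.intCast_zmod_eq_zero_iff_dvd _ _).1 h01
  obtain ⟨c, hc⟩ := (ZMod.intCast_zmod_eq_zero_iff_dvd _ _).1 h10
  rw [sub_eq_iff_eq_add] at ha hd
  rw [ha, hb, hc, hd] at hdet
  refine ⟨b * c - a * d, ?_⟩
  rw [ha, hd]
  linear_combination hdet

lemma traceSet_mono {H K : Subgroup SL(2, ℤ)} (h : H ≤ K) : traceSet H ⊆ traceSet K :=
  fun _ ⟨γ, hγ, ht⟩ ↦ ⟨γ, h hγ, ht⟩

lemma T_zpow_mem_Gamma (n : ℕ) : T ^ (n : ℤ) ∈ CongruenceSubgroup.Gamma n := by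
  rw [CongruenceSubgroup.Gamma_mem, coe_T_zpow]
  simp

lemma lowerUnipotent_mem_Gamma {n : ℕ} {b : ℤ} (h : (n : ℤ) ∣ b) :
    lowerUnipotent b ∈ CongruenceSubgroup.Gamma n := by
  rw [CongruenceSubgroup.Gamma_mem, coe_lowerUnipotent]
  simp [ZMod.intCast_zmod_eq_zero_iff_dvd, h]

lemma trace_T_zpow_zpow_mul_lowerUnipotent (a b k : ℤ) :
    Matrix.trace (((T ^ a) ^ k * lowerUnipotent b : SL(2, ℤ)) : Matrix (Fin 2) (Fin 2) ℤ) =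
      2 + a * b * k := by
  rw [← zpow_mul, Matrix.SpecialLinearGroup.coe_mul, coe_T_zpow, coe_lowerUnipotent,
    Matrix.mul_fin_two, Matrix.trace_fin_two_of]
  ring

/-- For every `n ≥ 2`, there is a finitely generated subgroup of the principal congruence
subgroup `Γ(n)` which has infinite index in `SL(2, ℤ)` and the same trace set as `Γ(n)`. -/
theorem exists_fg_infinite_index_subgroup_traceSet_Gamma (n : ℕ) (hn : 2 ≤ n) :
    ∃ H : Subgroup SL(2, ℤ), H ≤ CongruenceSubgroup.Gamma n ∧ H.FG ∧ H.index = 0 ∧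
      traceSet H = traceSet (CongruenceSubgroup.Gamma n) := by
  obtain rfl | hn3 := hn.eq_or_lt
  · have hle : Subgroup.closure {T ^ (2 : ℤ), lowerUnipotent 4, -1} ≤
        CongruenceSubgroup.Gamma 2 := by
      rw [Subgroup.closure_le]
      rintro _ (rfl | rfl | rfl)
      · exact T_zpow_mem_Gamma 2
      · exact lowerUnipotent_mem_Gamma (by norm_num)
      · rw [SetLike.mem_coe, CongruenceSubgroup.Gamma_mem]
        simp
    refine ⟨_, hle, Subgroup.fg_iff _ |>.2 ⟨_, rfl, Set.toFinite _⟩,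
      index_closure_unipotentPair (p := 2) (q := 3) (by norm_num) (by norm_num) (by norm_num)
        (by norm_num) (by norm_num [pingPongRegion]), (traceSet_mono hle).antisymm ?_⟩
    rintro _ ⟨γ, hγ, rfl⟩
    obtain ⟨k, hk⟩ := exists_trace_eq_of_mem_Gamma hγ
    rw [hk]
    have hmem (l : ℤ) : (T ^ (2 : ℤ)) ^ l * lowerUnipotent 4 ∈
        Subgroup.closure {T ^ (2 : ℤ), lowerUnipotent 4, -1} :=
      mul_mem (zpow_mem (Subgroup.subset_closure (by simp)) l)
        (Subgroup.subset_closure (by simp))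
    obtain ⟨l, rfl | rfl⟩ := k.even_or_odd'
    · refine ⟨_, hmem l, ?_⟩
      rw [trace_T_zpow_zpow_mul_lowerUnipotent]
      push_cast
      ring
    · refine ⟨-1 * _, mul_mem (Subgroup.subset_closure (by simp)) (hmem (-l - 1)), ?_⟩
      rw [neg_one_mul, Matrix.SpecialLinearGroup.coe_neg, Matrix.trace_neg,
        trace_T_zpow_zpow_mul_lowerUnipotent]
      push_cast
      ring
  · have hle : Subgroup.closure {T ^ (n : ℤ), lowerUnipotent n} ≤
        CongruenceSubgroup.Gamma n := by
      rw [Subgroup.closure_le]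
      rintro _ (rfl | rfl)
      · exact T_zpow_mem_Gamma n
      · exact lowerUnipotent_mem_Gamma dvd_rfl
    have hn' : (3 : ℤ) ≤ n := by exact_mod_cast hn3
    have hsub : Subgroup.closure {T ^ (n : ℤ), lowerUnipotent n} ≤
        Subgroup.closure {T ^ (n : ℤ), lowerUnipotent n, -1} :=
      Subgroup.closure_mono (by grind)
    refine ⟨_, hle, Subgroup.fg_iff _ |>.2 ⟨_, rfl, Set.toFinite _⟩,
      Nat.eq_zero_of_zero_dvd ?_, (traceSet_mono hle).antisymm ?_⟩
    · rw [← index_closure_unipotentPair (a := n) (b := n) (p := 1) (q := 1) (by omega) (by omega)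
        (by nlinarith) one_ne_zero (by simp [pingPongRegion]; omega)]
      exact Subgroup.index_dvd_of_le hsub
    · rintro _ ⟨γ, hγ, rfl⟩
      obtain ⟨k, hk⟩ := exists_trace_eq_of_mem_Gamma hγ
      rw [hk]
      exact ⟨_, mul_mem (zpow_mem (Subgroup.subset_closure (by simp)) k)
        (Subgroup.subset_closure (by simp)), trace_T_zpow_zpow_mul_lowerUnipotent n n k⟩
end
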